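/- arXiv:2405.02140 — 2 statements merged into one kernel-verified Lean document; each statement's English description precedes it below -/
import Mathlib

section
/- Let (X_1,Y_1),...,(X_n,Y_n) be exchangeable random variables taking values in 𝒳 × 𝒴, let s : 𝒳 × 𝒴 → ℝ be a score function, and let S_i = s(X_i,Y_i). For a new draw (X_test, Y_test) exchangeable with the others and any α ∈ (0,1), define the prediction set C(X_test) = { y ∈ 𝒴 : s(X_test, y) ≤ Quantile(1−α; {S_1,...,S_n} ∪ {∞}) }. Then P(Y_test ∈ C(X_test)) ≥ 1 − α. If moreover the scores S_1,...,S_n, s(X_test,Y_test) are almost surely distinct, then P(Y_test ∈ C(X_test)) ≤ 1 − α + 1/(n+1). -/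
open MeasureTheory

/-- Level-`β` quantile of the empirical distribution of the points `z 0, ..., z (m-1)`
(values in `EReal` so that `∞` can be one of the points):
`inf { t : (1/m) · #{i : z i ≤ t} ≥ β }`. -/
noncomputable def empiricalQuantile {m : ℕ} (β : ℝ) (z : Fin m → EReal) : EReal :=
  sInf {t : EReal | β ≤ ((Finset.univ.filter fun i => z i ≤ t).card : ℝ) / m}


/-- Number of indices with value strictly below that of `j`. -/
noncomputable def rankBelow {m : ℕ} (v : Fin m → ℝ) (j : Fin m) : ℝ :=
  ((Finset.univ.filter fun i => v i < v j).card : ℝ)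

lemma rankBelow_perm {m : ℕ} (v : Fin m → ℝ) (π : Equiv.Perm (Fin m)) (j : Fin m) :
    rankBelow (fun i => v (π i)) j = rankBelow v (π j) := by
  unfold rankBelow
  congr 1
  refine Finset.card_bij (fun i _ => π i) ?_ ?_ ?_
  · intro i hi
    simpa using hi
  · intro a _ b _ h
    exact π.injective h
  · intro b hb
    exact ⟨π.symm b, by simpa using hb, by simp⟩

lemma count_lower {m : ℕ} (v : Fin m → ℝ) (c : ℝ) (hc : c ≤ m) :
    c ≤ ((Finset.univ.filter fun j => rankBelow v j < c).card : ℝ) := by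
  classical
  by_cases hB : (Finset.univ.filter fun j => c ≤ rankBelow v j).Nonempty
  · obtain ⟨j, hj, hmin⟩ := Finset.exists_min_image _ v hB
    have hj' : c ≤ rankBelow v j := by simpa using hj
    refine hj'.trans ?_
    unfold rankBelow
    refine Nat.cast_le.mpr (Finset.card_le_card ?_)
    intro i hi
    have hi' : v i < v j := by simpa using hi
    simp only [Finset.mem_filter, Finset.mem_univ, true_and]
    by_contra hcon
    have := hmin i (by
      refine Finset.mem_filter.mpr ⟨Finset.mem_univ _, ?_⟩
      exact not_lt.mp hcon)
    linarith
  · have hall : (Finset.univ.filter fun j => rankBelow v j < c) = Finset.univ := by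
      ext j
      simp only [Finset.mem_filter, Finset.mem_univ, true_and, iff_true]
      by_contra hcon
      exact hB ⟨j, by simpa using hcon⟩
    rw [hall]
    simpa using hc

lemma count_upper {m : ℕ} (v : Fin m → ℝ) (hv : Function.Injective v) (c : ℝ) (hc : 0 ≤ c) :
    ((Finset.univ.filter fun j => rankBelow v j < c).card : ℝ) ≤ c + 1 := by
  classical
  by_cases hB : (Finset.univ.filter fun j => rankBelow v j < c).Nonempty
  · obtain ⟨j, hj, hmax⟩ := Finset.exists_max_image _ v hB
    have hj' : rankBelow v j < c := by simpa using hj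
    have hsub : (Finset.univ.filter fun j => rankBelow v j < c) ⊆
        insert j (Finset.univ.filter fun i => v i < v j) := by
      intro i hi
      have h1 := hmax i hi
      rcases h1.lt_or_eq with h | h
      · simp [h]
      · simp [hv h]
    have h2 := (Finset.card_le_card hsub).trans (Finset.card_insert_le _ _)
    have h3 : ((Finset.univ.filter fun j => rankBelow v j < c).card : ℝ) ≤ rankBelow v j + 1 := by
      unfold rankBelow
      exact_mod_cast h2
    linarith
  · rw [Finset.not_nonempty_iff_eq_empty] at hB
    rw [hB]
    simp
    linarith

lemma le_quantile_iff {n : ℕ} (v : Fin (n + 1) → ℝ) (β : ℝ) (hβ : 0 < β) :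
    ((v (Fin.last n) : ℝ) : EReal) ≤
      empiricalQuantile β (Fin.snoc (fun i : Fin n => ((v i.castSucc : ℝ) : EReal)) (⊤ : EReal)) ↔
    rankBelow v (Fin.last n) < β * ((n + 1 : ℕ) : ℝ) := by
  classical
  have hm : (0 : ℝ) < ((n + 1 : ℕ) : ℝ) := by positivity
  set z : Fin (n + 1) → EReal :=
    Fin.snoc (fun i : Fin n => ((v i.castSucc : ℝ) : EReal)) (⊤ : EReal) with hz
  have hzc : ∀ i : Fin n, z i.castSucc = ((v i.castSucc : ℝ) : EReal) := by
    intro i; simp [hz]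
  have hzl : z (Fin.last n) = ⊤ := by simp [hz]
  unfold empiricalQuantile
  rw [le_sInf_iff]
  constructor
  · intro h
    by_contra hcon
    push Not at hcon
    have hne : (Finset.univ.filter fun i => v i < v (Fin.last n)).Nonempty := by
      rw [← Finset.card_pos]
      have : 0 < rankBelow v (Fin.last n) := lt_of_lt_of_le (by positivity) hcon
      unfold rankBelow at this
      exact_mod_cast this
    obtain ⟨j, hj, hmax⟩ := Finset.exists_max_image _ v hne
    have hj' : v j < v (Fin.last n) := by simpa using hj
    have h1 := h ((v j : ℝ) : EReal) (by
      simp only [Set.mem_ofPred_eq]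
      rw [le_div_iff₀ hm]
      refine hcon.trans ?_
      unfold rankBelow
      refine Nat.cast_le.mpr (Finset.card_le_card ?_)
      intro i hi
      have h2 := hmax i hi
      have hi' : v i < v (Fin.last n) := by simpa using hi
      simp only [Finset.mem_filter, Finset.mem_univ, true_and]
      induction i using Fin.lastCases with
      | last => exact absurd hi' (lt_irrefl _)
      | cast i => rw [hzc]; exact_mod_cast h2)
    have h3 : v (Fin.last n) ≤ v j := by exact_mod_cast h1
    linarith
  · intro h t ht
    by_contra hcon
    push Not at hcon
    simp only [Set.mem_ofPred_eq] at ht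
    rw [le_div_iff₀ hm] at ht
    refine absurd (lt_of_le_of_lt ht ?_) (lt_irrefl _)
    refine lt_of_le_of_lt ?_ h
    unfold rankBelow
    refine Nat.cast_le.mpr (Finset.card_le_card ?_)
    intro i hi
    have hi' : z i ≤ t := by simpa using hi
    simp only [Finset.mem_filter, Finset.mem_univ, true_and]
    have h4 := lt_of_le_of_lt hi' hcon
    induction i using Fin.lastCases with
    | last => rw [hzl] at h4; exact absurd h4 (by simp)
    | cast i => rw [hzc] at h4; exact_mod_cast h4

lemma measurable_rankBelow {m : ℕ} (j : Fin m) :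
    Measurable (fun v : Fin m → ℝ => rankBelow v j) := by
  classical
  unfold rankBelow
  simp only [Finset.card_filter, Nat.cast_sum]
  refine Finset.measurable_sum _ fun i _ => ?_
  simp only [Nat.cast_ite]
  exact Measurable.ite (measurableSet_lt (measurable_pi_apply i) (measurable_pi_apply j))
    measurable_const measurable_const

/-- Split conformal prediction: marginal coverage guarantee.
The `n` calibration points are indexed by `i.castSucc` for `i : Fin n`, and the test
point is indexed by `Fin.last n`.  The prediction set is
`C(X_test) = { y : s(X_test, y) ≤ Quantile(1-α; {S_1,...,S_n} ∪ {∞}) }`.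
Then `P(Y_test ∈ C(X_test)) ≥ 1 - α`, and if the scores are a.s. distinct,
`P(Y_test ∈ C(X_test)) ≤ 1 - α + 1/(n+1)`. -/
theorem conformal_prediction_coverage
    {Ω : Type*} [MeasurableSpace Ω] (P : Measure Ω) [IsProbabilityMeasure P]
    {𝒳 𝒴 : Type*} [MeasurableSpace 𝒳] [MeasurableSpace 𝒴]
    (n : ℕ) (hn : 0 < n)
    (X : Fin (n + 1) → Ω → 𝒳) (Y : Fin (n + 1) → Ω → 𝒴)
    (hX : ∀ i, Measurable (X i)) (hY : ∀ i, Measurable (Y i))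
    -- exchangeability of the n calibration points together with the test point
    (hexch : ∀ π : Equiv.Perm (Fin (n + 1)),
      P.map (fun ω => fun i => (X (π i) ω, Y (π i) ω)) =
        P.map (fun ω => fun i => (X i ω, Y i ω)))
    (s : 𝒳 × 𝒴 → ℝ) (hs : Measurable s)
    (α : ℝ) (hα : α ∈ Set.Ioo (0 : ℝ) 1)
    -- calibration scores
    (S : Fin n → Ω → ℝ)
    (hS : ∀ i : Fin n, S i = fun ω => s (X i.castSucc ω, Y i.castSucc ω))
    -- the quantile threshold, computed on the calibration scores together with ∞
    (q : Ω → EReal)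
    (hq : ∀ ω, q ω =
      empiricalQuantile (1 - α) (Fin.snoc (fun i => ((S i ω : ℝ) : EReal)) (⊤ : EReal)))
    -- the prediction set at the test input
    (C : Ω → Set 𝒴)
    (hC : ∀ ω, C ω = {y : 𝒴 | ((s (X (Fin.last n) ω, y) : ℝ) : EReal) ≤ q ω}) :
    1 - α ≤ (P {ω | Y (Fin.last n) ω ∈ C ω}).toReal ∧
      ((∀ᵐ ω ∂P, Function.Injective
          (Fin.snoc (fun i => S i ω) (s (X (Fin.last n) ω, Y (Fin.last n) ω))
            : Fin (n + 1) → ℝ)) →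
        (P {ω | Y (Fin.last n) ω ∈ C ω}).toReal ≤ 1 - α + 1 / (n + 1)) := by
  classical
  obtain ⟨hα0, hα1⟩ := hα
  set V : Ω → Fin (n + 1) → ℝ := fun ω i => s (X i ω, Y i ω) with hV
  set c : ℝ := (1 - α) * ((n + 1 : ℕ) : ℝ) with hc
  have hm : (0 : ℝ) < ((n + 1 : ℕ) : ℝ) := by positivity
  have hVm : Measurable V :=
    measurable_pi_lambda _ fun i => hs.comp ((hX i).prodMk (hY i))
  set A : Fin (n + 1) → Set Ω := fun j => {ω | rankBelow (V ω) j < c} with hA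
  have hAm : ∀ j, MeasurableSet (A j) := fun j =>
    measurableSet_lt ((measurable_rankBelow j).comp hVm) measurable_const
  have hev : {ω | Y (Fin.last n) ω ∈ C ω} = A (Fin.last n) := by
    ext ω
    have := le_quantile_iff (V ω) (1 - α) (by linarith)
    simp only [Set.mem_ofPred_eq, hC, hq, hS, hA, hc]
    exact this
  have heq : ∀ j, P (A j) = P (A (Fin.last n)) := by
    intro j
    have hπ := hexch (Equiv.swap j (Fin.last n))
    set D : Set (Fin (n + 1) → 𝒳 × 𝒴) :=
      {w | rankBelow (fun i => s (w i)) (Fin.last n) < c} with hD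
    have hDm : MeasurableSet D :=
      measurableSet_lt ((measurable_rankBelow (Fin.last n)).comp
        (measurable_pi_lambda _ fun i => hs.comp (measurable_pi_apply i))) measurable_const
    have h1 := congrArg (fun μ => μ D) hπ
    rw [Measure.map_apply (measurable_pi_lambda _ fun i => (hX _).prodMk (hY _)) hDm,
      Measure.map_apply (measurable_pi_lambda _ fun i => (hX _).prodMk (hY _)) hDm] at h1
    have h2 : (fun ω => fun i => (X (Equiv.swap j (Fin.last n) i) ω,
        Y (Equiv.swap j (Fin.last n) i) ω)) ⁻¹' D = A j := by
      ext ω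
      have := rankBelow_perm (V ω) (Equiv.swap j (Fin.last n)) (Fin.last n)
      rw [Equiv.swap_apply_right] at this
      simp only [Set.mem_preimage, hD, hA, Set.mem_ofPred_eq]
      rw [← this]
    rw [h2] at h1
    exact h1
  have hint : ∀ j, Integrable ((A j).indicator (fun _ => (1 : ℝ))) P := fun j =>
    (integrable_const (1 : ℝ)).indicator (hAm j)
  have hcount : ∀ ω, ∑ j, (A j).indicator (fun _ => (1 : ℝ)) ω =
      ((Finset.univ.filter fun j => rankBelow (V ω) j < c).card : ℝ) := by
    intro ω
    simp [Set.indicator_apply, hA]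
  have hsum : ∫ ω, ∑ j, (A j).indicator (fun _ => (1 : ℝ)) ω ∂P =
      ((n + 1 : ℕ) : ℝ) * (P (A (Fin.last n))).toReal := by
    rw [integral_finsetSum _ fun j _ => hint j]
    have : ∀ j, ∫ ω, (A j).indicator (fun _ => (1 : ℝ)) ω ∂P = (P (A (Fin.last n))).toReal := by
      intro j
      rw [integral_indicator (hAm j), ← heq j]
      simp [Measure.real]
    simp [this]
  have hsint : Integrable (fun ω => ∑ j, (A j).indicator (fun _ => (1 : ℝ)) ω) P :=
    integrable_finsetSum _ fun j _ => hint j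
  rw [hev]
  constructor
  · have h1 : ∫ _, c ∂P ≤ ∫ ω, ∑ j, (A j).indicator (fun _ => (1 : ℝ)) ω ∂P := by
      refine integral_mono (integrable_const c) hsint fun ω => ?_
      simp only [hcount]
      exact count_lower _ _ (by rw [hc]; nlinarith)
    rw [hsum] at h1
    simp only [integral_const, probReal_univ, one_smul] at h1
    rw [hc, mul_comm] at h1
    exact le_of_mul_le_mul_left h1 hm
  · intro hinj
    have h1 : ∫ ω, ∑ j, (A j).indicator (fun _ => (1 : ℝ)) ω ∂P ≤ ∫ _, (c + 1) ∂P := by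
      refine integral_mono_ae hsint (integrable_const _) ?_
      filter_upwards [hinj] with ω hω
      simp only [hcount]
      refine count_upper _ ?_ _ (by rw [hc]; exact mul_nonneg (by linarith) hm.le)
      convert hω using 1
      funext i
      induction i using Fin.lastCases with
      | last => simp [hV]
      | cast i => simp [hV, hS]
    rw [hsum] at h1
    simp only [integral_const, probReal_univ, one_smul] at h1
    refine le_of_mul_le_mul_left (h1.trans (le_of_eq ?_)) hm
    rw [hc]
    push_cast
    field_simp
end

section
/- (Fano's inequality for variable-size list decoding) Let Y be a random variable taking values in a finite set 𝒴 with |𝒴| = M, let Ŷ be a random variable jointly distributed with Y, and let L be a map that assigns to every realization of Ŷ a nonempty list L(Ŷ) ⊆ 𝒴. Define P_e := P(Y ∉ L(Ŷ)). Then H(Y|Ŷ) ≤ h_b(P_e) + P_e·log M + E[log |L(Ŷ)|]. -/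
open Finset

/-- **Fano's inequality for variable-size list decoding.**  Discrete setting: `Y` takes
values in a finite set `𝒴` with `|𝒴| = M`, `Ŷ` is a random variable jointly distributed
with `Y` (joint pmf `p : 𝒴̂ × 𝒴 → ℝ`), and `L` assigns to every realization of `Ŷ` a
nonempty list `L(Ŷ) ⊆ 𝒴`.  With `P_e := P(Y ∉ L(Ŷ))`,
`H(Y|Ŷ) ≤ h_b(P_e) + P_e·log M + E[log |L(Ŷ)|]`. -/
theorem fano_variable_size_list_decoding
    {𝒴hat 𝒴 : Type*} [Fintype 𝒴hat] [Fintype 𝒴] [DecidableEq 𝒴]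
    (M : ℕ) (hM : Fintype.card 𝒴 = M)
    -- joint pmf of (Ŷ, Y)
    (p : 𝒴hat → 𝒴 → ℝ) (hp0 : ∀ yh y, 0 ≤ p yh y) (hp1 : ∑ yh, ∑ y, p yh y = 1)
    -- the list decoder, with nonempty lists
    (L : 𝒴hat → Finset 𝒴) (hL : ∀ yh, (L yh).Nonempty)
    -- the error probability P_e = P(Y ∉ L(Ŷ))
    (Pe : ℝ)
    (hPe : Pe = ∑ yh, ∑ y, p yh y * (if y ∈ L yh then (0 : ℝ) else 1)) :
    -- H(Y|Ŷ) ≤ h_b(P_e) + P_e log M + E[log |L(Ŷ)|]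
    (-∑ yh, ∑ y, p yh y * Real.log (p yh y / ∑ y', p yh y')) ≤
      (-Pe * Real.log Pe - (1 - Pe) * Real.log (1 - Pe))
        + Pe * Real.log (M : ℝ)
        + ∑ yh, ∑ y, p yh y * Real.log ((L yh).card : ℝ) := by
  have hM0 : ∀ y : 𝒴, (0:ℝ) < M := fun y => by
    rw [← hM]; exact_mod_cast Fintype.card_pos_iff.mpr ⟨y⟩
  have hLc : ∀ yh, (0:ℝ) < (L yh).card := fun yh => by exact_mod_cast (hL yh).card_pos
  have hPe' : 1 - Pe = ∑ yh, ∑ y, p yh y * (if y ∈ L yh then (1 : ℝ) else 0) := by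
    rw [hPe, ← hp1, ← Finset.sum_sub_distrib]
    refine Finset.sum_congr rfl fun yh _ => ?_
    rw [← Finset.sum_sub_distrib]
    refine Finset.sum_congr rfl fun y _ => ?_
    rw [hp1]; split_ifs <;> ring
  have hle1 : ∀ yh y, p yh y * (if y ∈ L yh then (0 : ℝ) else 1) ≤ Pe := fun yh y => by
    have h0 : ∀ a b, 0 ≤ p a b * (if b ∈ L a then (0 : ℝ) else 1) := fun a b =>
      mul_nonneg (hp0 a b) (by split_ifs <;> norm_num)
    rw [hPe]
    exact (Finset.single_le_sum (f := fun b => p yh b * (if b ∈ L yh then (0 : ℝ) else 1))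
      (fun b _ => h0 yh b) (Finset.mem_univ y)).trans
      (Finset.single_le_sum (f := fun a => ∑ b, p a b * (if b ∈ L a then (0 : ℝ) else 1))
      (fun a _ => Finset.sum_nonneg fun b _ => h0 a b) (Finset.mem_univ yh))
  have hle2 : ∀ yh y, p yh y * (if y ∈ L yh then (1 : ℝ) else 0) ≤ 1 - Pe := fun yh y => by
    have h0 : ∀ a b, 0 ≤ p a b * (if b ∈ L a then (1 : ℝ) else 0) := fun a b =>
      mul_nonneg (hp0 a b) (by split_ifs <;> norm_num)
    rw [hPe']
    exact (Finset.single_le_sum (f := fun b => p yh b * (if b ∈ L yh then (1 : ℝ) else 0))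
      (fun b _ => h0 yh b) (Finset.mem_univ y)).trans
      (Finset.single_le_sum (f := fun a => ∑ b, p a b * (if b ∈ L a then (1 : ℝ) else 0))
      (fun a _ => Finset.sum_nonneg fun b _ => h0 a b) (Finset.mem_univ yh))
  have hPe0 : 0 ≤ Pe := by
    rw [hPe]
    exact Finset.sum_nonneg fun a _ => Finset.sum_nonneg fun b _ =>
      mul_nonneg (hp0 a b) (by split_ifs <;> norm_num)
  have hPe1 : 0 ≤ 1 - Pe := by
    rw [hPe']
    exact Finset.sum_nonneg fun a _ => Finset.sum_nonneg fun b _ =>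
      mul_nonneg (hp0 a b) (by split_ifs <;> norm_num)
  -- the reference conditional law
  obtain ⟨q, hq⟩ : ∃ q : 𝒴hat → 𝒴 → ℝ, ∀ yh y,
      q yh y = if y ∈ L yh then (1 - Pe) / (L yh).card else Pe / M := ⟨_, fun _ _ => rfl⟩
  have hqsum : ∀ yh, ∑ y, q yh y ≤ 1 := fun yh => by
    obtain ⟨y0, _⟩ := hL yh
    have hM1 := hM0 y0
    have h1 : ∑ y, q yh y ≤
        ∑ y, ((if y ∈ L yh then (1 - Pe) / ((L yh).card : ℝ) else 0) + Pe / M) := by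
      refine Finset.sum_le_sum fun y _ => ?_
      rw [hq]
      have : 0 ≤ Pe / M := by positivity
      split_ifs <;> linarith
    refine h1.trans (le_of_eq ?_)
    rw [Finset.sum_add_distrib, Finset.sum_ite_mem, Finset.univ_inter, Finset.sum_const,
      Finset.sum_const, Finset.card_univ, hM, nsmul_eq_mul, nsmul_eq_mul,
      mul_div_cancel₀ _ (hLc yh).ne', mul_div_cancel₀ _ hM1.ne']
    ring
  have hs0 : ∀ yh, 0 ≤ ∑ y', p yh y' := fun yh => Finset.sum_nonneg fun b _ => hp0 yh b
  have hq0 : ∀ yh y, 0 ≤ q yh y := fun yh y => by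
    rw [hq]
    split_ifs <;> positivity
  have key : ∀ yh y, -(p yh y * Real.log (p yh y / ∑ y', p yh y')) ≤
      (p yh y * (if y ∈ L yh then (0 : ℝ) else 1)) * (Real.log M - Real.log Pe)
      + (p yh y * (if y ∈ L yh then (1 : ℝ) else 0)) * (- Real.log (1 - Pe))
      + p yh y * Real.log ((L yh).card : ℝ)
      + ((∑ y', p yh y') * q yh y - p yh y) := fun yh y => by
    rcases (hp0 yh y).eq_or_lt with h | ha
    · rw [← h]
      have := mul_nonneg (hs0 yh) (hq0 yh y)
      simpa using this
    have hs : 0 < ∑ y', p yh y' := lt_of_lt_of_le ha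
      (Finset.single_le_sum (f := fun b => p yh b) (fun b _ => hp0 yh b) (Finset.mem_univ y))
    have hM1 := hM0 y
    have hc := hLc yh
    have hlc : 0 ≤ Real.log ((L yh).card : ℝ) := Real.log_natCast_nonneg _
    have h1 := hle1 yh y
    have h2 := hle2 yh y
    have hqy := hq yh y
    generalize (∑ y', p yh y') = s at *
    generalize p yh y = a at *
    generalize q yh y = r at *
    have gibbs : 0 < r → -(a * Real.log (a / s)) ≤ -(a * Real.log r) + (s * r - a) := by
      intro hr
      have h3 := Real.log_le_sub_one_of_pos (x := s * r / a) (by positivity)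
      rw [Real.log_div (by positivity) ha.ne', Real.log_mul hs.ne' hr.ne'] at h3
      rw [Real.log_div ha.ne' hs.ne']
      have h4 := mul_le_mul_of_nonneg_left h3 ha.le
      have h5 : a * (s * r / a - 1) = s * r - a := by field_simp
      rw [h5] at h4
      linarith
    by_cases hy : y ∈ L yh
    · simp only [hy, if_true, mul_one, mul_zero, zero_mul, zero_add] at *
      have hp : 0 < 1 - Pe := by linarith
      have := gibbs (by rw [hqy]; positivity)
      have hl : Real.log r = Real.log (1 - Pe) - Real.log ((L yh).card : ℝ) := by
        rw [hqy, Real.log_div hp.ne' hc.ne']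
      rw [hl] at this
      linarith
    · simp only [hy, if_false, mul_one, mul_zero, zero_mul, add_zero] at *
      have hp : 0 < Pe := by linarith
      have := gibbs (by rw [hqy]; positivity)
      have hl : Real.log r = Real.log Pe - Real.log (M : ℝ) := by
        rw [hqy, Real.log_div hp.ne' hM1.ne']
      rw [hl] at this
      have := mul_nonneg ha.le hlc
      linarith
  have hsum := Finset.sum_le_sum fun yh (_ : yh ∈ Finset.univ) =>
    Finset.sum_le_sum fun y (_ : y ∈ Finset.univ) => key yh y
  simp only [Finset.sum_add_distrib, Finset.sum_sub_distrib, Finset.sum_neg_distrib,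
    ← Finset.sum_mul, ← Finset.mul_sum] at hsum
  rw [← hPe, ← hPe', hp1] at hsum
  have hfin : ∑ yh, (∑ y', p yh y') * ∑ y, q yh y ≤ 1 := by
    rw [← hp1]
    exact Finset.sum_le_sum fun yh _ => mul_le_of_le_one_right (hs0 yh) (hqsum yh)
  simp only [← Finset.sum_mul] at hsum ⊢
  linarith
end
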